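/- Let n ≥ 1 and 1 ≤ r ≤ n be integers, let A ⊆ {-1,1}^n be nonempty with |A| = M = α·2^n, and define ω_i := Σ_{k=0}^r K_k^(n)(i) for 0 ≤ i ≤ n. Suppose real numbers x_1, …, x_n satisfy x_k ≥ 0 for all k ∈ [1,n] and Σ_{k=1}^n [K_k^(n)(1) − K_k^(n)(i)]·x_k ≥ −(ω_1 − ω_i) for all i ∈ [2,n]. Then Σ_{i=2}^n Q^(A)(i)·(ω_1 − ω_i) ≥ −Σ_{k=1}^n [K_k^(n)(0) + K_k^(n)(1)·(1/α − 1)]·x_k. -/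

import Mathlib

open Finset

noncomputable section

/-- Generalized binomial coefficient `C(x, j) = x(x-1)⋯(x-j+1)/j!` for real `x`. -/
def rchoose (x : ℝ) (j : ℕ) : ℝ := (∏ i ∈ Finset.range j, (x - i)) / (Nat.factorial j)

/-- Krawtchouk polynomial `K_k^(n)(x) = Σ_{j=0}^k (-1)^j C(x,j) C(n-x, k-j)`. -/
def kraw (n k : ℕ) (x : ℝ) : ℝ :=
  ∑ j ∈ Finset.range (k + 1), (-1 : ℝ) ^ j * rchoose x j * rchoose ((n : ℝ) - x) (k - j)

/-- Fourier coefficient `f̂_S = E[f(X) χ_S(X)]`, where `χ_S(x) = Π_{i ∈ S} x_i`. -/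
def fCoeff (n : ℕ) (f : (Fin n → ℤˣ) → ℝ) (S : Finset (Fin n)) : ℝ :=
  (∑ x : Fin n → ℤˣ, f x * ∏ i ∈ S, ((x i : ℤ) : ℝ)) / 2 ^ n

/-- Degree-`k` Fourier weight `W_k[f] = Σ_{|S| = k} f̂_S²`. -/
def fWeight (n : ℕ) (f : (Fin n → ℤˣ) → ℝ) (k : ℕ) : ℝ :=
  ∑ S ∈ Finset.univ.filter (fun S : Finset (Fin n) => S.card = k), (fCoeff n f S) ^ 2

/-- Indicator function of a set `A` of vertices of `{-1,1}^n` (modeled as `Fin n → ℤˣ`). -/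
def indic (n : ℕ) (A : Finset (Fin n → ℤˣ)) : (Fin n → ℤˣ) → ℝ :=
  fun x => if x ∈ A then 1 else 0

/-- `ω_i := Σ_{k=0}^r K_k^(n)(i)`. -/
def omegaLP (n r : ℕ) (i : ℕ) : ℝ := ∑ k ∈ Finset.range (r + 1), kraw n k (i : ℝ)

theorem rchoose_natCast (m j : ℕ) : rchoose (m : ℝ) j = (m.choose j : ℝ) := by
  rw [rchoose, ← descPochhammer_eval_eq_prod_range, descPochhammer_eval_eq_descFactorial,
    Nat.descFactorial_eq_factorial_mul_choose]
  have := Nat.factorial_ne_zero j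
  push_cast
  field_simp

open Polynomial in
theorem coeff_one_sub_X_pow_real (m j : ℕ) :
    ((1 - X : ℝ[X]) ^ m).coeff j = (-1) ^ j * (m.choose j : ℝ) := by
  have h : (1 - X : ℝ[X]) ^ m = ((1 + X : ℝ[X]) ^ m).comp (C (-1) * X) := by
    simp [sub_eq_add_neg]
  rw [h, comp_C_mul_X_coeff, coeff_one_add_X_pow, mul_comm]

open Polynomial in
/-- Values of Krawtchouk polynomials at integers are coefficients of `(1 - X)^i (1 + X)^(n - i)`. -/
theorem kraw_eq_coeff (n k i : ℕ) (hi : i ≤ n) :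
    kraw n k (i : ℝ) = ((1 - X : ℝ[X]) ^ i * (1 + X) ^ (n - i)).coeff k := by
  rw [coeff_mul, Finset.Nat.sum_antidiagonal_eq_sum_range_succ_mk, kraw]
  refine Finset.sum_congr rfl fun j _ => ?_
  rw [← Nat.cast_sub hi, rchoose_natCast, rchoose_natCast, coeff_one_sub_X_pow_real,
    coeff_one_add_X_pow]

open Polynomial in
/-- Krawtchouk polynomials are the character sums over Hamming spheres. -/
theorem kraw_card_eq_sum (n k : ℕ) (S : Finset (Fin n)) :
    kraw n k (S.card : ℝ) =
      ∑ T ∈ Finset.univ.filter (fun T : Finset (Fin n) => T.card = k),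
        ∏ i ∈ S, (if i ∈ T then (-1 : ℝ) else 1) := by
  have hS : S.card ≤ n := by simpa using Finset.card_le_univ S
  have h : (1 - X : ℝ[X]) ^ S.card * (1 + X) ^ (n - S.card) =
      ∏ i : Fin n, (1 + C (if i ∈ S then (-1 : ℝ) else 1) * X) := by
    have h1 : ∀ i : Fin n, (1 + C (if i ∈ S then (-1 : ℝ) else 1) * X : ℝ[X]) =
        if i ∈ S then 1 - X else 1 + X := by
      intro i
      split_ifs <;> simp [sub_eq_add_neg]
    simp_rw [h1]
    rw [Finset.prod_ite]
    have hc : (Finset.univ.filter fun i : Fin n => i ∉ S) = Sᶜ := by ext; simp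
    simp [hc, Finset.card_compl]
  rw [kraw_eq_coeff n k _ hS, h, Finset.prod_one_add, finsetSum_coeff, Finset.powerset_univ,
    Finset.sum_filter]
  refine Finset.sum_congr rfl fun T _ => ?_
  rw [Finset.prod_mul_distrib, Finset.prod_const, ← map_prod, coeff_C_mul, coeff_X_pow]
  by_cases hT : T.card = k
  · rw [if_pos hT, if_pos hT.symm, mul_one]
    simp [Finset.inter_comm]
  · rw [if_neg hT, if_neg (Ne.symm hT), mul_zero]

/-- Fourier inversion for the autocorrelation of `f`, before evaluating the kernel. -/
theorem sum_fCoeff_sq_mul_prod (n : ℕ) (f : (Fin n → ℤˣ) → ℝ) (y : Fin n → ℝ) :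
    ∑ S : Finset (Fin n), fCoeff n f S ^ 2 * ∏ i ∈ S, y i =
      (∑ u : Fin n → ℤˣ, ∑ v : Fin n → ℤˣ, f u * f v *
        ∏ i, (1 + ((u i : ℤ) : ℝ) * ((v i : ℤ) : ℝ) * y i)) / (2 ^ n) ^ 2 := by
  simp_rw [Finset.prod_one_add, Finset.powerset_univ, fCoeff, div_pow, div_mul_eq_mul_div,
    ← Finset.sum_div, sq (∑ u : Fin n → ℤˣ, _), Finset.sum_mul_sum, Finset.sum_mul,
    Finset.mul_sum]
  congr 1
  rw [Finset.sum_comm]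
  refine Finset.sum_congr rfl fun u _ => ?_
  rw [Finset.sum_comm]
  refine Finset.sum_congr rfl fun v _ => Finset.sum_congr rfl fun S _ => ?_
  simp_rw [Finset.prod_mul_distrib]
  ring

theorem sum_fCoeff_sq_mul_prod_nonneg (n : ℕ) (f : (Fin n → ℤˣ) → ℝ) (hf : ∀ u, 0 ≤ f u)
    (T : Finset (Fin n)) :
    0 ≤ ∑ S : Finset (Fin n), fCoeff n f S ^ 2 * ∏ i ∈ S, (if i ∈ T then (-1 : ℝ) else 1) := by
  rw [sum_fCoeff_sq_mul_prod]
  refine div_nonneg (Finset.sum_nonneg fun u _ => Finset.sum_nonneg fun v _ =>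
    mul_nonneg (mul_nonneg (hf u) (hf v)) (Finset.prod_nonneg fun i _ => ?_)) (by positivity)
  rcases Int.units_eq_one_or (u i) with hu | hu <;> rcases Int.units_eq_one_or (v i) with hv | hv <;>
    split_ifs <;> norm_num [hu, hv]

/-- Parseval's identity. -/
theorem sum_fCoeff_sq (n : ℕ) (f : (Fin n → ℤˣ) → ℝ) :
    ∑ S : Finset (Fin n), fCoeff n f S ^ 2 = (∑ u, f u ^ 2) / 2 ^ n := by
  have h := sum_fCoeff_sq_mul_prod n f (fun _ => 1)
  have hker : ∀ u v : Fin n → ℤˣ, ∏ i, (1 + ((u i : ℤ) : ℝ) * ((v i : ℤ) : ℝ)) =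
      if u = v then (2 : ℝ) ^ n else 0 := by
    intro u v
    split_ifs with huv
    · subst huv
      have : ∀ i, (1 + ((u i : ℤ) : ℝ) * ((u i : ℤ) : ℝ)) = 2 := by
        intro i
        rcases Int.units_eq_one_or (u i) with hu | hu <;> norm_num [hu]
      simp [this]
    · obtain ⟨i, hi⟩ := Function.ne_iff.mp huv
      refine Finset.prod_eq_zero (Finset.mem_univ i) ?_
      rcases Int.units_eq_one_or (u i) with hu | hu <;>
        rcases Int.units_eq_one_or (v i) with hv | hv <;> simp_all
  simp only [Finset.prod_const_one, mul_one, hker, mul_ite, mul_zero, Finset.sum_ite_eq,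
    Finset.mem_univ, if_true] at h
  rw [h, ← Finset.sum_mul, sq ((2 : ℝ) ^ n), mul_div_mul_right _ _ (by positivity)]
  simp_rw [sq]

theorem sum_fWeight_mul (n : ℕ) (f : (Fin n → ℤˣ) → ℝ) (g : ℕ → ℝ) :
    ∑ i ∈ Finset.range (n + 1), fWeight n f i * g i =
      ∑ S : Finset (Fin n), fCoeff n f S ^ 2 * g S.card := by
  rw [← Finset.sum_fiberwise_of_maps_to (s := Finset.univ) (t := Finset.range (n + 1))
    (g := Finset.card)
    (fun S _ => Finset.mem_range_succ_iff.mpr (by simpa using Finset.card_le_univ S))]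
  refine Finset.sum_congr rfl fun i _ => ?_
  rw [fWeight, Finset.sum_mul]
  refine Finset.sum_congr rfl fun S hS => ?_
  rw [(Finset.mem_filter.mp hS).2]

theorem fWeight_nonneg (n : ℕ) (f : (Fin n → ℤˣ) → ℝ) (k : ℕ) : 0 ≤ fWeight n f k :=
  Finset.sum_nonneg fun _ _ => sq_nonneg _

/-- Delsarte's inequalities for the Fourier weights of a nonnegative function. -/
theorem sum_fWeight_mul_kraw_nonneg (n k : ℕ) (f : (Fin n → ℤˣ) → ℝ) (hf : ∀ u, 0 ≤ f u) :
    0 ≤ ∑ i ∈ Finset.range (n + 1), fWeight n f i * kraw n k (i : ℝ) := by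
  rw [sum_fWeight_mul n f fun i => kraw n k (i : ℝ)]
  simp_rw [kraw_card_eq_sum, Finset.mul_sum]
  rw [Finset.sum_comm]
  exact Finset.sum_nonneg fun T _ => sum_fCoeff_sq_mul_prod_nonneg n f hf T

theorem sum_fWeight_indic (n : ℕ) (A : Finset (Fin n → ℤˣ)) :
    ∑ i ∈ Finset.range (n + 1), fWeight n (indic n A) i = (A.card : ℝ) / 2 ^ n := by
  have h := sum_fWeight_mul n (indic n A) fun _ => 1
  simp only [mul_one] at h
  rw [h, sum_fCoeff_sq]
  simp [indic]

theorem fWeight_zero_indic (n : ℕ) (A : Finset (Fin n → ℤˣ)) :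
    fWeight n (indic n A) 0 = ((A.card : ℝ) / 2 ^ n) ^ 2 := by
  simp [fWeight, fCoeff, indic, Finset.card_eq_zero, Finset.filter_eq']

theorem sum_range_succ_eq_add_sum_Icc_two (n : ℕ) (hn : 1 ≤ n) (g : ℕ → ℝ) :
    ∑ i ∈ Finset.range (n + 1), g i = g 0 + g 1 + ∑ i ∈ Finset.Icc 2 n, g i := by
  rw [Finset.range_eq_Ico, Finset.sum_eq_sum_Ico_succ_bot (by omega),
    Finset.sum_eq_sum_Ico_succ_bot (by omega), ← add_assoc]
  rfl

/-- Summing the constraint of the dual program for a fixed `k` against the Fourier weights. -/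
theorem sum_fWeight_mul_kraw_sub_le (n k : ℕ) (hn : 1 ≤ n) (A : Finset (Fin n → ℤˣ)) (α : ℝ)
    (hα0 : 0 < α) (hα : (A.card : ℝ) = α * 2 ^ n) :
    ∑ i ∈ Finset.Icc 2 n, fWeight n (indic n A) i / α ^ 2 * (kraw n k 1 - kraw n k (i : ℝ)) ≤
      kraw n k 0 + kraw n k 1 * (1 / α - 1) := by
  have hcard : (A.card : ℝ) / 2 ^ n = α := by rw [hα]; field_simp
  have hnn := sum_fWeight_mul_kraw_nonneg n k (indic n A)
    (fun u => by unfold indic; split_ifs <;> norm_num)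
  have hsplit := sum_range_succ_eq_add_sum_Icc_two n hn
    fun i => fWeight n (indic n A) i * (kraw n k 1 - kraw n k (i : ℝ))
  have htot : ∑ i ∈ Finset.range (n + 1),
      fWeight n (indic n A) i * (kraw n k 1 - kraw n k (i : ℝ)) =
      α * kraw n k 1 -
        ∑ i ∈ Finset.range (n + 1), fWeight n (indic n A) i * kraw n k (i : ℝ) := by
    simp_rw [mul_sub, Finset.sum_sub_distrib, ← Finset.sum_mul]
    rw [sum_fWeight_indic, hcard]
  rw [htot] at hsplit
  simp only [fWeight_zero_indic, hcard, Nat.cast_zero, Nat.cast_one, sub_self, mul_zero,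
    add_zero] at hsplit
  simp_rw [div_mul_eq_mul_div, ← Finset.sum_div]
  rw [div_le_iff₀ (by positivity)]
  have hrhs : (kraw n k 0 + kraw n k 1 * (1 / α - 1)) * α ^ 2 =
      α * kraw n k 1 - α ^ 2 * (kraw n k 1 - kraw n k 0) := by
    field_simp
    ring
  linarith

/-- weak LP duality, Theorem 7: any feasible solution `x` of the dual
program lower-bounds `Σ_{i=2}^n Q^(A)(i)(ω_1 − ω_i)`, where `Q^(A)(i) = W_i[1_A]/α²`. -/
theorem lp_weak_duality (n r : ℕ) (hn : 1 ≤ n) (hr1 : 1 ≤ r) (hrn : r ≤ n)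
    (A : Finset (Fin n → ℤˣ)) (hA : A.Nonempty) (α : ℝ)
    (hα : (A.card : ℝ) = α * 2 ^ n)
    (x : ℕ → ℝ)
    (hx0 : ∀ k ∈ Finset.Icc 1 n, 0 ≤ x k)
    (hfeas : ∀ i ∈ Finset.Icc 2 n,
      -(omegaLP n r 1 - omegaLP n r i) ≤
        ∑ k ∈ Finset.Icc 1 n, (kraw n k 1 - kraw n k (i : ℝ)) * x k) :
    -∑ k ∈ Finset.Icc 1 n, (kraw n k 0 + kraw n k 1 * (1 / α - 1)) * x k ≤
      ∑ i ∈ Finset.Icc 2 n, (fWeight n (indic n A) i / α ^ 2) * (omegaLP n r 1 - omegaLP n r i) := by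
  have hα0 : 0 < α := by
    have h : (0 : ℝ) < α * 2 ^ n := hα ▸ Nat.cast_pos.mpr hA.card_pos
    exact pos_of_mul_pos_left h (by positivity)
  calc -∑ k ∈ Finset.Icc 1 n, (kraw n k 0 + kraw n k 1 * (1 / α - 1)) * x k
      ≤ -∑ k ∈ Finset.Icc 1 n, (∑ i ∈ Finset.Icc 2 n,
          fWeight n (indic n A) i / α ^ 2 * (kraw n k 1 - kraw n k (i : ℝ))) * x k :=
        neg_le_neg (Finset.sum_le_sum fun k hk => mul_le_mul_of_nonneg_right
          (sum_fWeight_mul_kraw_sub_le n k hn A α hα0 hα) (hx0 k hk))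
    _ = ∑ i ∈ Finset.Icc 2 n, fWeight n (indic n A) i / α ^ 2 *
          -∑ k ∈ Finset.Icc 1 n, (kraw n k 1 - kraw n k (i : ℝ)) * x k := by
        simp_rw [mul_neg, Finset.sum_neg_distrib, Finset.sum_mul, Finset.mul_sum, mul_assoc]
        rw [Finset.sum_comm]
    _ ≤ _ := Finset.sum_le_sum fun i hi => mul_le_mul_of_nonneg_left
        (neg_le.mp (hfeas i hi)) (div_nonneg (fWeight_nonneg _ _ _) (sq_nonneg α))
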